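/- arXiv:1711.03139 — 5 statements merged into one kernel-verified Lean document; each statement's English description precedes it below -/
import Mathlib

section
/- Let V be a real vector space with a nondegenerate symmetric bilinear form B, with B-orthogonal decompositions V = U₁ ⊕ ⋯ ⊕ U_p ⊕ N (the summands pairwise B-orthogonal, each U_i two-dimensional with B restricted to U_i nondegenerate and indefinite, and N negative definite) and V = P ⊕ L, where L is a line and P is the B-orthogonal complement of L. Assume dim(P ∩ U_i) = 1 for each i = 1,…,p. Then there exists a p-dimensional positive-definite subspace V′ ⊆ P satisfying V′ = (V′ ∩ U₁) ⊕ ⋯ ⊕ (V′ ∩ U_p) if and only if for every i = 1,…,p the line P ∩ U_i is positive (spanned by a vector v with B(v,v) > 0). -/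
/-- Lemma on intersecting flats and hyperplanes. Let `V` be a real vector space
with a nondegenerate symmetric bilinear form `B`, together with `B`-orthogonal decompositions
`V = U₁ ⊕ ⋯ ⊕ U_p ⊕ N` (each `U i` two-dimensional with `B` restricted to it nondegenerate and
indefinite, `N` negative definite) and `V = P ⊕ L` with `L` a line and `P` its `B`-orthogonal
complement. Assume `dim (P ∩ U i) = 1` for all `i`. Then a `p`-dimensional positive-definite
subspace `V' ⊆ P` with `V' = (V' ∩ U₁) ⊕ ⋯ ⊕ (V' ∩ U_p)` exists iff each line `P ∩ U i` is
positive. -/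
theorem exists_positive_definite_subspace_iff
    (V : Type*) [AddCommGroup V] [Module ℝ V]
    (B : LinearMap.BilinForm ℝ V)
    (hsymm : ∀ x y, B x y = B y x)
    (hnd : ∀ x, (∀ y, B x y = 0) → x = 0)
    (p : ℕ) (U : Fin p → Submodule ℝ V) (N P L : Submodule ℝ V)
    -- `V = U₁ ⊕ ⋯ ⊕ U_p ⊕ N` is a `B`-orthogonal direct sum decomposition
    (hindep : iSupIndep (fun o : Option (Fin p) => o.elim N U))
    (hspan : (⨆ o : Option (Fin p), o.elim N U) = ⊤)
    (horth : ∀ o o' : Option (Fin p), o ≠ o' →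
      ∀ x ∈ o.elim N U, ∀ y ∈ o'.elim N U, B x y = 0)
    -- each `U i` is two-dimensional, with `B` restricted to it nondegenerate and indefinite
    (hU2 : ∀ i, Module.finrank ℝ ↥(U i) = 2)
    (hUnd : ∀ i, ∀ x ∈ U i, (∀ y ∈ U i, B x y = 0) → x = 0)
    (hUindef : ∀ i, (∃ x ∈ U i, 0 < B x x) ∧ (∃ x ∈ U i, B x x < 0))
    -- `N` is negative definite
    (hNneg : ∀ x ∈ N, x ≠ 0 → B x x < 0)
    -- `V = P ⊕ L`, `L` a line, `P` the `B`-orthogonal complement of `L`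
    (hL : Module.finrank ℝ ↥L = 1)
    (hP : ∀ x, x ∈ P ↔ ∀ y ∈ L, B x y = 0)
    (hPL : IsCompl P L)
    -- `dim (P ∩ U i) = 1` for each `i`
    (hPU : ∀ i, Module.finrank ℝ ↥(P ⊓ U i) = 1) :
    (∃ V' : Submodule ℝ V, V' ≤ P ∧ Module.finrank ℝ ↥V' = p ∧
        (∀ v ∈ V', v ≠ 0 → 0 < B v v) ∧ V' = ⨆ i, V' ⊓ U i) ↔
      (∀ i, ∃ v : V, 0 < B v v ∧ P ⊓ U i = Submodule.span ℝ {v}) := by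
  constructor
  · rintro ⟨V', hV'P, hrank, hpos, hV'⟩ j
    have hinf : ∃ v ∈ V' ⊓ U j, v ≠ 0 := by
      classical
      by_contra! hbot
      choose w hw using fun i => (finrank_eq_one_iff' (K := ℝ) (V := ↥(P ⊓ U i))).1 (hPU i)
      have hle : V' ≤ Submodule.span ℝ
          (((Finset.univ.erase j).image fun i => (w i : V) : Finset V) : Set V) := by
        rw [hV']
        refine iSup_le fun i x hx => ?_
        by_cases hij : i = j
        · subst hij
          rw [hbot x hx]
          exact zero_mem _
        · obtain ⟨c, hc⟩ := (hw i).2 ⟨x, hV'P hx.1, hx.2⟩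
          have hcx : c • (w i : V) = x := congrArg Subtype.val hc
          rw [← hcx]
          refine Submodule.smul_mem _ _ (Submodule.subset_span ?_)
          exact Finset.mem_coe.2 (Finset.mem_image_of_mem _ (by simp [hij]))
      have hcard : p ≤ (Finset.univ.erase j).card :=
        hrank.symm.le.trans <| (Submodule.finrank_mono hle).trans
          ((finrank_span_finset_le_card _).trans Finset.card_image_le)
      rw [Finset.card_erase_of_mem (Finset.mem_univ j), Finset.card_univ, Fintype.card_fin] at hcard
      have := j.isLt
      omega
    obtain ⟨v, hv, hv0⟩ := hinf
    have hvPU : v ∈ P ⊓ U j := ⟨hV'P hv.1, hv.2⟩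
    refine ⟨v, hpos v hv.1 hv0, le_antisymm (fun x hx => ?_) ?_⟩
    · obtain ⟨c, hc⟩ := (finrank_eq_one_iff_of_nonzero' (⟨v, hvPU⟩ : ↥(P ⊓ U j))
        (fun h => hv0 (congrArg Subtype.val h))).1 (hPU j) ⟨x, hx⟩
      exact Submodule.mem_span_singleton.2 ⟨c, congrArg Subtype.val hc⟩
    · exact (Submodule.span_singleton_le_iff_mem _ _).2 hvPU
  · intro h
    choose v hv hspanv using h
    have hmem : ∀ i, v i ∈ P ⊓ U i := fun i =>
      hspanv i ▸ Submodule.mem_span_singleton_self (v i)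
    have hind : LinearIndependent ℝ v :=
      (hindep.comp (Option.some_injective _)).linearIndependent (fun i => U i)
        (fun i => (hmem i).2) (fun i h0 => by simpa [h0] using hv i)
    have hleP : Submodule.span ℝ (Set.range v) ≤ P :=
      Submodule.span_le.2 (Set.range_subset_iff.2 fun i => (hmem i).1)
    refine ⟨Submodule.span ℝ (Set.range v), hleP, ?_, ?_, ?_⟩
    · rw [finrank_span_eq_card hind, Fintype.card_fin]
    · intro x hx hx0
      obtain ⟨c, rfl⟩ := (Submodule.mem_span_range_iff_exists_fun ℝ).1 hx
      have hBx : B (∑ i, c i • v i) (∑ i, c i • v i) = ∑ i, c i ^ 2 * B (v i) (v i) := by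
        simp only [map_sum, LinearMap.sum_apply, map_smul, LinearMap.smul_apply, smul_eq_mul]
        refine Finset.sum_congr rfl fun i _ => ?_
        rw [Finset.sum_eq_single i]
        · ring
        · intro k _ hki
          rw [horth (some k) (some i) (by simpa using hki) _ (hmem k).2 _ (hmem i).2]
          simp
        · simp
      obtain ⟨i, hi⟩ : ∃ i, c i ≠ 0 := by
        by_contra! hc
        exact hx0 (by simp [hc])
      rw [hBx]
      exact Finset.sum_pos' (fun k _ => mul_nonneg (sq_nonneg _) (hv k).le)
        ⟨i, Finset.mem_univ i, mul_pos (by positivity) (hv i)⟩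
    · refine le_antisymm (Submodule.span_le.2 (Set.range_subset_iff.2 fun i => ?_))
        (iSup_le fun i => inf_le_left)
      exact Submodule.mem_iSup_of_mem i
        ⟨Submodule.subset_span (Set.mem_range_self i), (hmem i).2⟩
end

section
/- With the standard setup below (2 ≤ p ≤ q, reals a > b > 0 with a² − b² = 1, θ ∈ ℝ): (i) there exists a p-dimensional positive-definite subspace V′ ⊆ P with V′ = (V′ ∩ U₁) ⊕ ⋯ ⊕ (V′ ∩ U_p); and (ii) for every integer k ≥ 1 with cos(kθ) ≠ 0, if −(a+b) ≤ tan(kθ) ≤ −(a−b), then there is no p-dimensional positive-definite subspace V′ ⊆ P satisfying V′ = (V′ ∩ r^k U₁) ⊕ (V′ ∩ r^k U₂) ⊕ (V′ ∩ U₃) ⊕ ⋯ ⊕ (V′ ∩ U_p). -/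
open Real

/-- The diagonal weights of the form `B` of signature `(p, q)`: `+1` on the `e`-coordinates,
`−1` on the `f`-coordinates. -/
def sigWeights (p q : ℕ) : Fin p ⊕ Fin q → ℝ :=
  Sum.elim (fun _ => 1) (fun _ => -1)

/-- The symmetric bilinear form `B` of signature `(p, q)` on `ℝ^{p+q}`, with
`B(e_i, e_i) = 1`, `B(f_j, f_j) = −1` and distinct basis vectors orthogonal. -/
noncomputable def formB (p q : ℕ) :
    LinearMap.BilinForm ℝ ((Fin p ⊕ Fin q) → ℝ) :=
  Matrix.toLinearMap₂' ℝ (Matrix.diagonal (sigWeights p q))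

/-- The basis vector `e_i`. -/
def eVec (p q : ℕ) (i : Fin p) : (Fin p ⊕ Fin q) → ℝ := Pi.single (Sum.inl i) 1

/-- The basis vector `f_j`. -/
def fVec (p q : ℕ) (j : Fin q) : (Fin p ⊕ Fin q) → ℝ := Pi.single (Sum.inr j) 1

/-- The plane `U_i = span{e_i, f_i}` (for `1 ≤ i ≤ p`, using `p ≤ q`). -/
def planeU (p q : ℕ) (hpq : p ≤ q) (i : Fin p) : Submodule ℝ ((Fin p ⊕ Fin q) → ℝ) :=
  Submodule.span ℝ {eVec p q i, fVec p q (Fin.castLE hpq i)}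

/-- The vector `λ = b e₁ + a f₁ + f₂ + ⋯ + f_p`. -/
noncomputable def lamVec (p q : ℕ) (hp : 0 < p) (hpq : p ≤ q) (a b : ℝ) :
    (Fin p ⊕ Fin q) → ℝ :=
  b • eVec p q ⟨0, hp⟩ + a • fVec p q (Fin.castLE hpq ⟨0, hp⟩) +
    ∑ j ∈ Finset.univ.erase (⟨0, hp⟩ : Fin p), fVec p q (Fin.castLE hpq j)

/-- The subspace `P = λ^⊥`, the `B`-orthogonal complement of the line spanned by `λ`. -/
noncomputable def hyperP (p q : ℕ) (hp : 0 < p) (hpq : p ≤ q) (a b : ℝ) :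
    Submodule ℝ ((Fin p ⊕ Fin q) → ℝ) :=
  LinearMap.ker (formB p q (lamVec p q hp hpq a b))

/-- The rotation `r` by angle `θ` in the `(e₁, e₂)`- and `(f₁, f₂)`-planes, fixing all other basis
vectors. -/
noncomputable def rotR (p q : ℕ) (hp : 2 ≤ p) (hq : 2 ≤ q) (θ : ℝ) :
    Module.End ℝ ((Fin p ⊕ Fin q) → ℝ) :=
  (Pi.basisFun ℝ (Fin p ⊕ Fin q)).constr ℝ fun i =>
    if i = Sum.inl ⟨0, by omega⟩ then
      Real.cos θ • eVec p q ⟨0, by omega⟩ + Real.sin θ • eVec p q ⟨1, by omega⟩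
    else if i = Sum.inl ⟨1, by omega⟩ then
      (-Real.sin θ) • eVec p q ⟨0, by omega⟩ + Real.cos θ • eVec p q ⟨1, by omega⟩
    else if i = Sum.inr ⟨0, by omega⟩ then
      Real.cos θ • fVec p q ⟨0, by omega⟩ + Real.sin θ • fVec p q ⟨1, by omega⟩
    else if i = Sum.inr ⟨1, by omega⟩ then
      (-Real.sin θ) • fVec p q ⟨0, by omega⟩ + Real.cos θ • fVec p q ⟨1, by omega⟩
    else Pi.single i 1

/-- The existence of a `p`-dimensional `B`-positive-definite subspace `V' ⊆ P` that is the
(direct) sum of its intersections with the given family `W` of subspaces. -/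
def ExistsGoodSubspace (p q : ℕ) (P : Submodule ℝ ((Fin p ⊕ Fin q) → ℝ))
    (W : Fin p → Submodule ℝ ((Fin p ⊕ Fin q) → ℝ)) : Prop :=
  ∃ V' : Submodule ℝ ((Fin p ⊕ Fin q) → ℝ), V' ≤ P ∧ Module.finrank ℝ ↥V' = p ∧
    (∀ v ∈ V', v ≠ 0 → 0 < formB p q v v) ∧ V' = ⨆ i, V' ⊓ W i

section

open Module Submodule

section General

variable {K E ι : Type*} [Field K] [AddCommGroup E] [Module K E]

theorem finrank_finsetSup_le_sum [FiniteDimensional K E] (A : ι → Submodule K E)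
    (s : Finset ι) : finrank K ↥(s.sup A) ≤ ∑ i ∈ s, finrank K ↥(A i) := by
  classical
  induction s using Finset.induction_on with
  | empty => simp
  | insert i s hi ih =>
    rw [Finset.sup_insert, Finset.sum_insert hi]
    exact (finrank_add_le_finrank_add_finrank _ _).trans (by gcongr)

/-- If lines or zero subspaces indexed by `ι` span a subspace of dimension `card ι`, none of them
is zero. -/
theorem ne_bot_of_eq_iSup_of_finrank_eq_card [FiniteDimensional K E] [Fintype ι]
    {V : Submodule K E} {A : ι → Submodule K E} (hV : V = ⨆ i, A i)
    (hcard : finrank K V = Fintype.card ι) (hA : ∀ i, finrank K ↥(A i) ≤ 1) (i : ι) :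
    A i ≠ ⊥ := by
  intro hi
  have hle := finrank_finsetSup_le_sum A Finset.univ
  rw [Finset.sup_univ_eq_iSup, ← hV, hcard] at hle
  have hlt : ∑ j, finrank K ↥(A j) < ∑ _j : ι, 1 :=
    Finset.sum_lt_sum (fun j _ => hA j) ⟨i, Finset.mem_univ i, by simp [hi]⟩
  simp only [Finset.sum_const, Finset.card_univ, smul_eq_mul, mul_one] at hlt
  omega

/-- A subspace of a plane `span {x, y}` that misses `y` is at most one-dimensional. -/
theorem finrank_inf_span_pair_le_one [FiniteDimensional K E] (V : Submodule K E) (x y : E)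
    (hy : y ∉ V) : finrank K ↥(V ⊓ span K {x, y}) ≤ 1 := by
  classical
  have hlt : V ⊓ span K {x, y} < span K {x, y} :=
    lt_of_le_of_ne inf_le_right fun h => hy <| (h.ge.trans inf_le_left) (subset_span (by simp))
  have h₁ := finrank_lt_finrank_of_lt hlt
  have h₂ : finrank K ↥(span K ({x, y} : Set E)) ≤ 2 := by
    have := (finrank_span_finset_le_card (R := K) ({x, y} : Finset E)).trans Finset.card_le_two
    rwa [Set.finrank, Finset.coe_pair] at this
  omega

end General

section Orthonormal

variable {E ι : Type*} [AddCommGroup E] [Module ℝ E] [Fintype ι] [DecidableEq ι]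
  (B : LinearMap.BilinForm ℝ E) (v : ι → E)

theorem bilinForm_sum_smul_self_of_orthonormal (hv : ∀ i j, B (v i) (v j) = if i = j then 1 else 0)
    (c : ι → ℝ) : B (∑ i, c i • v i) (∑ i, c i • v i) = ∑ i, c i ^ 2 := by
  simp [hv, sq]

theorem linearIndependent_of_bilinForm_orthonormal
    (hv : ∀ i j, B (v i) (v j) = if i = j then 1 else 0) : LinearIndependent ℝ v := by
  refine Fintype.linearIndependent_iff.mpr fun c hc i => ?_
  have h := bilinForm_sum_smul_self_of_orthonormal B v hv c
  rw [hc, map_zero, eq_comm, Finset.sum_eq_zero_iff_of_nonneg fun i _ => sq_nonneg _] at h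
  exact pow_eq_zero_iff two_ne_zero |>.mp (h i (Finset.mem_univ i))

theorem bilinForm_pos_of_mem_span_orthonormal
    (hv : ∀ i j, B (v i) (v j) = if i = j then 1 else 0) {x : E}
    (hx : x ∈ span ℝ (Set.range v)) (hx0 : x ≠ 0) : 0 < B x x := by
  obtain ⟨c, rfl⟩ := (mem_span_range_iff_exists_fun ℝ).mp hx
  rw [bilinForm_sum_smul_self_of_orthonormal B v hv]
  refine (Finset.sum_nonneg fun i _ => sq_nonneg _).lt_of_ne' fun h => hx0 ?_
  rw [Finset.sum_eq_zero_iff_of_nonneg fun i _ => sq_nonneg _] at h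
  exact Finset.sum_eq_zero fun i hi => by simp [pow_eq_zero_iff two_ne_zero |>.mp (h i hi)]

end Orthonormal

section Signature

variable {p q : ℕ}

theorem formB_eVec (x : Fin p ⊕ Fin q → ℝ) (i : Fin p) :
    formB p q x (eVec p q i) = x (Sum.inl i) := by
  simp [formB, eVec, sigWeights, Matrix.toLinearMap₂'_apply', Matrix.mulVec_single,
    dotProduct, Pi.single_apply]

theorem formB_fVec (x : Fin p ⊕ Fin q → ℝ) (j : Fin q) :
    formB p q x (fVec p q j) = -x (Sum.inr j) := by
  simp [formB, fVec, sigWeights, Matrix.toLinearMap₂'_apply', Matrix.mulVec_single,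
    dotProduct, Pi.single_apply]

theorem eVec_inl (i j : Fin p) : eVec p q i (Sum.inl j) = if j = i then 1 else 0 := by
  simp [eVec, Pi.single_apply]

theorem eVec_inr (i : Fin p) (j : Fin q) : eVec p q i (Sum.inr j) = 0 := by
  simp [eVec]

theorem fVec_inl (i : Fin q) (j : Fin p) : fVec p q i (Sum.inl j) = 0 := by
  simp [fVec]

theorem fVec_inr (i j : Fin q) : fVec p q i (Sum.inr j) = if j = i then 1 else 0 := by
  simp [fVec, Pi.single_apply]

theorem lamVec_inl (hp : 0 < p) (hpq : p ≤ q) (a b : ℝ) (i : Fin p) :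
    lamVec p q hp hpq a b (Sum.inl i) = if i = ⟨0, hp⟩ then b else 0 := by
  simp [lamVec, eVec_inl, fVec_inl]

theorem lamVec_inr (hp : 0 < p) (hpq : p ≤ q) (a b : ℝ) (i : Fin p) :
    lamVec p q hp hpq a b (Sum.inr (Fin.castLE hpq i)) = if i = ⟨0, hp⟩ then a else 1 := by
  simp only [lamVec, Pi.add_apply, Pi.smul_apply, eVec_inr, fVec_inr, Finset.sum_apply,
    Fin.castLE_inj, smul_eq_mul, Finset.sum_ite_eq, Finset.mem_erase, Finset.mem_univ]
  split_ifs <;> simp_all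

theorem mem_hyperP (hp : 0 < p) (hpq : p ≤ q) (a b : ℝ) (x : Fin p ⊕ Fin q → ℝ) :
    x ∈ hyperP p q hp hpq a b ↔ formB p q (lamVec p q hp hpq a b) x = 0 :=
  LinearMap.mem_ker

theorem existsGoodSubspace_planeU (hp : 0 < p) (hpq : p ≤ q) {a b : ℝ} (hab : a ^ 2 - b ^ 2 = 1) :
    ExistsGoodSubspace p q (hyperP p q hp hpq a b) (planeU p q hpq) := by
  set v : Fin p → (Fin p ⊕ Fin q → ℝ) := fun i =>
    if i = ⟨0, hp⟩ then a • eVec p q i + b • fVec p q (Fin.castLE hpq i) else eVec p q i with hvdef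
  have hv : ∀ i j, formB p q (v i) (v j) = if i = j then 1 else 0 := by
    intro i j
    simp only [hvdef]
    split_ifs <;>
      simp_all [formB_eVec, formB_fVec, eVec_inl, eVec_inr, fVec_inl, fVec_inr, eq_comm]
    linarith
  have hmem : ∀ i, v i ∈ planeU p q hpq i := by
    intro i
    simp only [hvdef, planeU]
    split_ifs
    · exact mem_span_pair.mpr ⟨a, b, rfl⟩
    · exact subset_span (by simp)
  refine ⟨span ℝ (Set.range v), ?_, ?_, fun x hx hx0 =>
    bilinForm_pos_of_mem_span_orthonormal _ v hv hx hx0, ?_⟩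
  · rw [span_le]
    rintro _ ⟨i, rfl⟩
    rw [SetLike.mem_coe, mem_hyperP]
    simp only [hvdef]
    split_ifs with hi
    · simp only [map_add, map_smul, formB_eVec, formB_fVec, lamVec_inl, lamVec_inr, hi, if_true,
        smul_eq_mul]
      ring
    · simp [formB_eVec, lamVec_inl, hi]
  · simpa using finrank_span_eq_card (linearIndependent_of_bilinForm_orthonormal _ v hv)
  · refine le_antisymm (span_le.mpr ?_) (iSup_le fun i => inf_le_left)
    rintro _ ⟨i, rfl⟩
    exact mem_iSup_of_mem i ⟨subset_span ⟨i, rfl⟩, hmem i⟩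

section Rotation

variable (hp : 2 ≤ p) (hq : 2 ≤ q) (θ : ℝ)

theorem rotR_eVec_zero : rotR p q hp hq θ (eVec p q ⟨0, by omega⟩) =
    cos θ • eVec p q ⟨0, by omega⟩ + sin θ • eVec p q ⟨1, by omega⟩ := by
  refine (congrArg _ (Pi.basisFun_apply ℝ _ _).symm).trans ?_
  rw [rotR, Basis.constr_basis]
  simp

theorem rotR_eVec_one : rotR p q hp hq θ (eVec p q ⟨1, by omega⟩) =
    (-sin θ) • eVec p q ⟨0, by omega⟩ + cos θ • eVec p q ⟨1, by omega⟩ := by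
  refine (congrArg _ (Pi.basisFun_apply ℝ _ _).symm).trans ?_
  rw [rotR, Basis.constr_basis]
  simp

theorem rotR_fVec_zero : rotR p q hp hq θ (fVec p q ⟨0, by omega⟩) =
    cos θ • fVec p q ⟨0, by omega⟩ + sin θ • fVec p q ⟨1, by omega⟩ := by
  refine (congrArg _ (Pi.basisFun_apply ℝ _ _).symm).trans ?_
  rw [rotR, Basis.constr_basis]
  simp

theorem rotR_fVec_one : rotR p q hp hq θ (fVec p q ⟨1, by omega⟩) =
    (-sin θ) • fVec p q ⟨0, by omega⟩ + cos θ • fVec p q ⟨1, by omega⟩ := by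
  refine (congrArg _ (Pi.basisFun_apply ℝ _ _).symm).trans ?_
  rw [rotR, Basis.constr_basis]
  simp

end Rotation

/-- The powers of an endomorphism that rotates `x, y` by the angle `θ` rotate by multiples
of `θ`. -/
theorem pow_apply_of_rotation {E : Type*} [AddCommGroup E] [Module ℝ E] (r : Module.End ℝ E)
    (θ : ℝ) {x y : E} (hx : r x = cos θ • x + sin θ • y) (hy : r y = (-sin θ) • x + cos θ • y)
    (k : ℕ) : (r ^ k) x = cos (k * θ) • x + sin (k * θ) • y ∧
      (r ^ k) y = (-sin (k * θ)) • x + cos (k * θ) • y := by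
  induction k with
  | zero => simp
  | succ k ih =>
    have hk : ((k + 1 : ℕ) : ℝ) * θ = k * θ + θ := by push_cast; ring
    rw [hk, cos_add, sin_add, pow_succ, Module.End.mul_apply, Module.End.mul_apply, hx, hy]
    simp only [map_add, map_smul, ih.1, ih.2]
    constructor <;> module

theorem finrank_inf_map_planeU_le_one (hpq : p ≤ q) (V : Submodule ℝ (Fin p ⊕ Fin q → ℝ))
    (T : Module.End ℝ (Fin p ⊕ Fin q → ℝ)) (i : Fin p)
    (h : T (fVec p q (Fin.castLE hpq i)) ∉ V) :
    finrank ℝ ↥(V ⊓ (planeU p q hpq i).map T) ≤ 1 := by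
  have hmap : (planeU p q hpq i).map T =
      span ℝ {T (eVec p q i), T (fVec p q (Fin.castLE hpq i))} := by
    rw [planeU, map_span, Set.image_pair]
  rw [hmap]
  exact finrank_inf_span_pair_le_one V _ _ h

/-- The hyperplane `P` meets the rotated plane in a line that is not positive when the slope of the
rotation lies in `[-(a + b), -(a - b)]`. -/
theorem formB_self_nonpos_of_mem_hyperP (hp : 2 ≤ p) (hpq : p ≤ q) {a b c s : ℝ}
    (hb : 0 < b) (hsc : s ^ 2 + c ^ 2 = 1) (hc : c ≠ 0) (hlow : -(a + b) ≤ s / c)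
    (hupp : s / c ≤ -(a - b)) (x y : ℝ) {v : Fin p ⊕ Fin q → ℝ}
    (hv : v = x • (c • eVec p q ⟨0, by omega⟩ + s • eVec p q ⟨1, by omega⟩) +
      y • (c • fVec p q ⟨0, by omega⟩ + s • fVec p q ⟨1, by omega⟩))
    (hvP : v ∈ hyperP p q (by omega) hpq a b) : formB p q v v ≤ 0 := by
  rw [mem_hyperP, hv] at hvP
  have hr₀ := lamVec_inr (by omega : 0 < p) hpq a b ⟨0, by omega⟩
  have hr₁ := lamVec_inr (by omega : 0 < p) hpq a b ⟨1, by omega⟩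
  simp only [Fin.castLE_mk, Fin.mk.injEq, one_ne_zero, if_true, if_false] at hr₀ hr₁
  simp only [map_add, map_smul, formB_eVec, formB_fVec, lamVec_inl, hr₀, hr₁, Fin.mk.injEq,
    one_ne_zero, if_true, if_false, smul_eq_mul] at hvP
  have hvv : formB p q v v = x ^ 2 - y ^ 2 := by
    have : formB p q v v = (x ^ 2 - y ^ 2) * (s ^ 2 + c ^ 2) := by
      conv_lhs => rw [hv]
      simp only [map_add, map_smul, formB_eVec, formB_fVec, LinearMap.add_apply,
        LinearMap.smul_apply, eVec_inl, eVec_inr, fVec_inl, fVec_inr, Fin.mk.injEq, one_ne_zero,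
        zero_ne_one, if_true, if_false, smul_eq_mul]
      ring
    rw [this, hsc, mul_one]
  have ht : b * x = (a + s / c) * y := by
    field_simp
    linarith
  have htb : (a + s / c) ^ 2 ≤ b ^ 2 := sq_le_sq' (by linarith) (by linarith)
  have : b ^ 2 * x ^ 2 ≤ b ^ 2 * y ^ 2 := by
    rw [← mul_pow, ht, mul_pow]
    gcongr
  rw [hvv, sub_nonpos]
  exact le_of_mul_le_mul_left this (by positivity)

theorem not_existsGoodSubspace_rotated (hp : 2 ≤ p) (hpq : p ≤ q) {a b θ : ℝ}
    (hb : 0 < b) (k : ℕ) (hcos : cos (k * θ) ≠ 0) (hlow : -(a + b) ≤ tan (k * θ))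
    (hupp : tan (k * θ) ≤ -(a - b)) :
    ¬ ExistsGoodSubspace p q (hyperP p q (by omega) hpq a b)
      (fun i : Fin p =>
        if i = ⟨0, by omega⟩ then
          (planeU p q hpq ⟨0, by omega⟩).map (rotR p q hp (hp.trans hpq) θ ^ k)
        else if i = ⟨1, by omega⟩ then
          (planeU p q hpq ⟨1, by omega⟩).map (rotR p q hp (hp.trans hpq) θ ^ k)
        else planeU p q hpq i) := by
  rintro ⟨V, hVP, hdim, hpos, hV⟩
  have he₀ := (pow_apply_of_rotation _ θ (rotR_eVec_zero hp (hp.trans hpq) θ)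
    (rotR_eVec_one hp (hp.trans hpq) θ) k).1
  obtain ⟨hf₀, hf₁⟩ := pow_apply_of_rotation _ θ (rotR_fVec_zero hp (hp.trans hpq) θ)
    (rotR_fVec_one hp (hp.trans hpq) θ) k
  rw [tan_eq_sin_div_cos] at hlow hupp
  have hsc := sin_sq_add_cos_sq (k * θ)
  generalize cos (k * θ) = c at *
  generalize sin (k * θ) = s at *
  generalize rotR p q hp (hp.trans hpq) θ ^ k = T at *
  have hneg : ∀ y, formB p q y y = -1 → y ∉ V := by
    intro y hy hyV
    have hy0 : y ≠ 0 := by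
      rintro rfl
      simp at hy
    linarith [hpos y hyV hy0]
  have hTf₀ : T (fVec p q ⟨0, by omega⟩) ∉ V := by
    refine hneg _ ?_
    rw [hf₀]
    simp [formB_fVec, fVec_inr]
    linarith
  have hTf₁ : T (fVec p q ⟨1, by omega⟩) ∉ V := by
    refine hneg _ ?_
    rw [hf₁]
    simp [formB_fVec, fVec_inr]
    linarith
  have hline : V ⊓ (planeU p q hpq ⟨0, by omega⟩).map T ≠ ⊥ := by
    have h := ne_bot_of_eq_iSup_of_finrank_eq_card hV (by rw [hdim, Fintype.card_fin])
      (fun i => ?_) ⟨0, by omega⟩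
    · simpa only [if_true] using h
    · beta_reduce
      by_cases h₀ : i = ⟨0, by omega⟩
      · rw [if_pos h₀]
        exact finrank_inf_map_planeU_le_one hpq V T ⟨0, by omega⟩ hTf₀
      by_cases h₁ : i = ⟨1, by omega⟩
      · rw [if_neg h₀, if_pos h₁]
        exact finrank_inf_map_planeU_le_one hpq V T ⟨1, by omega⟩ hTf₁
      · rw [if_neg h₀, if_neg h₁]
        exact finrank_inf_span_pair_le_one V _ _ (hneg _ (by simp [formB_fVec, fVec_inr]))
  obtain ⟨v, ⟨hvV, hvT⟩, hv0⟩ := exists_mem_ne_zero_of_ne_bot hline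
  rw [SetLike.mem_coe, planeU, map_span, Set.image_pair, mem_span_pair] at hvT
  obtain ⟨x, y, hxy⟩ := hvT
  rw [Fin.castLE_mk, he₀, hf₀] at hxy
  exact (hpos v hvV hv0).not_ge <|
    formB_self_nonpos_of_mem_hyperP hp hpq hb hsc hcos hlow hupp x y hxy.symm (hVP hvV)

end Signature

end

/-- the intersection pattern `H₀ ∩ F₀ ≠ ∅` and `H₀ ∩ F_k = ∅`. With
`2 ≤ p ≤ q`, `a > b > 0`, `a² − b² = 1` and `θ ∈ ℝ`: (i) there is a `p`-dimensional
positive-definite subspace `V' ⊆ P` with `V' = ⊕ᵢ (V' ∩ Uᵢ)`; and (ii) for every `k ≥ 1` with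
`cos (kθ) ≠ 0` and `−(a+b) ≤ tan (kθ) ≤ −(a−b)`, there is no such subspace for the rotated family
`r^k U₁, r^k U₂, U₃, …, U_p`. -/
theorem flat_hyperplane_intersection_pattern
    (p q : ℕ) (hp : 2 ≤ p) (hpq : p ≤ q) (a b θ : ℝ)
    (hba : b < a) (hb : 0 < b) (hab : a ^ 2 - b ^ 2 = 1) :
    ExistsGoodSubspace p q (hyperP p q (by omega) hpq a b) (planeU p q hpq) ∧
    (∀ k : ℕ, 1 ≤ k → Real.cos (k * θ) ≠ 0 →
      -(a + b) ≤ Real.tan (k * θ) → Real.tan (k * θ) ≤ -(a - b) →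
      ¬ ExistsGoodSubspace p q (hyperP p q (by omega) hpq a b)
        (fun i : Fin p =>
          if i = ⟨0, by omega⟩ then
            (planeU p q hpq ⟨0, by omega⟩).map (rotR p q hp (hp.trans hpq) θ ^ k)
          else if i = ⟨1, by omega⟩ then
            (planeU p q hpq ⟨1, by omega⟩).map (rotR p q hp (hp.trans hpq) θ ^ k)
          else planeU p q hpq i)) := by
  exact ⟨existsGoodSubspace_planeU (by omega) hpq hab, fun k _ hcos hlow hupp =>
    not_existsGoodSubspace_rotated hp hpq hb k hcos hlow hupp⟩
end

section
/- Let V be a finite-dimensional real vector space with a nondegenerate symmetric bilinear form B, with B-orthogonal decompositions V = U₁ ⊕ ⋯ ⊕ U_p ⊕ N (pairwise B-orthogonal summands; each U_i two-dimensional of signature (1,1), i.e. B restricted to U_i is nondegenerate and indefinite; N negative definite) and V = P ⊕ L (L a line spanned by λ with B(λ,λ) < 0, and P the B-orthogonal complement of L). Assume the decompositions are in general position: P ∩ U_i is a positive line for each i, and N^⊥ ∩ L = {0}. Suppose g : V → V is a linear map preserving B (B(gx,gy) = B(x,y) for all x,y) such that: g(U_i) = U_i and g maps every isotropic line of U_i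 to itself, for each i = 1,…,p; g fixes N pointwise; and g(L) = L. Then g is the identity map. -/
/-- A linear endomorphism that preserves the form, fixes `y`, and preserves the line spanned by a
vector `x` not orthogonal to `y` fixes `x`. -/
theorem LinearMap.BilinForm.apply_eq_self_of_map_span_eq {K V : Type*} [Field K] [AddCommGroup V]
    [Module K V] {B : LinearMap.BilinForm K V} {g : V →ₗ[K] V}
    (hg : ∀ x y, B (g x) (g y) = B x y) {x y : V} (hy : g y = y)
    (hx : (Submodule.span K {x}).map g = Submodule.span K {x}) (hxy : B x y ≠ 0) :
    g x = x := by
  have hmem : g x ∈ Submodule.span K {x} :=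
    hx ▸ Submodule.mem_map_of_mem (Submodule.mem_span_singleton_self x)
  obtain ⟨c, hc⟩ := Submodule.mem_span_singleton.mp hmem
  have h := hg x y
  rw [hy, ← hc, map_smul, LinearMap.smul_apply, smul_eq_mul] at h
  rw [← hc, (mul_eq_right₀ hxy).mp h, one_smul]

/-- If `v` and `w` are orthogonal with `B v v > 0 > B w w`, then a linear map that fixes the
isotropic vectors of a subspace containing `v` and `w` fixes both `v` and `w`. -/
theorem LinearMap.BilinForm.apply_eq_self_of_fixes_isotropic {V : Type*} [AddCommGroup V]
    [Module ℝ V] {B : LinearMap.BilinForm ℝ V} (hsymm : ∀ x y, B x y = B y x) {g : V →ₗ[ℝ] V}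
    {U : Submodule ℝ V} (hg : ∀ x ∈ U, B x x = 0 → g x = x) {v w : V} (hv : v ∈ U) (hw : w ∈ U)
    (hvw : B v w = 0) (hvv : 0 < B v v) (hww : B w w < 0) :
    g v = v ∧ g w = w := by
  obtain ⟨t, ht, hpos⟩ : ∃ t : ℝ, B v v + t * t * B w w = 0 ∧ 0 < t := by
    have hquot : 0 < B v v / -B w w := div_pos hvv (neg_pos.mpr hww)
    refine ⟨√(B v v / -B w w), ?_, Real.sqrt_pos.mpr hquot⟩
    rw [Real.mul_self_sqrt hquot.le]
    field_simp [hww.ne]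
    ring
  have hwv : B w v = 0 := by rw [hsymm, hvw]
  have hadd : g (v + t • w) = v + t • w := by
    refine hg _ (U.add_mem hv (U.smul_mem t hw)) ?_
    simp only [map_add, map_smul, LinearMap.add_apply, LinearMap.smul_apply, smul_eq_mul, hvw, hwv]
    linarith
  have hsub : g (v - t • w) = v - t • w := by
    refine hg _ (U.sub_mem hv (U.smul_mem t hw)) ?_
    simp only [map_sub, map_smul, LinearMap.sub_apply, LinearMap.smul_apply, smul_eq_mul, hvw, hwv]
    linarith
  rw [map_add, map_smul] at hadd
  rw [map_sub, map_smul] at hsub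
  have hgv : g v = v := by
    have h : (2 : ℝ) • g v = (2 : ℝ) • v := by
      calc (2 : ℝ) • g v = (g v + t • g w) + (g v - t • g w) := by module
        _ = (2 : ℝ) • v := by rw [hadd, hsub]; module
    exact smul_right_injective V two_ne_zero h
  rw [hgv, add_right_inj] at hadd
  exact ⟨hgv, smul_right_injective V hpos.ne' hadd⟩


/-- the "general position implies trivial common stabilizer" claim. Let `V` be a
finite-dimensional real vector space with a nondegenerate symmetric bilinear form `B`, with
`B`-orthogonal decompositions `V = U₁ ⊕ ⋯ ⊕ U_p ⊕ N` (each `U i` of signature `(1,1)`, `N`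
negative definite) and `V = P ⊕ L` (`L` a negative line spanned by `λ`, `P` its `B`-orthogonal
complement), in general position. If a `B`-preserving linear map `g` preserves each `U i` and each
isotropic line of each `U i`, fixes `N` pointwise, and preserves `L`, then `g` is the identity. -/
theorem general_position_common_stabilizer_trivial
    (V : Type*) [AddCommGroup V] [Module ℝ V] [FiniteDimensional ℝ V]
    (B : LinearMap.BilinForm ℝ V)
    (hsymm : ∀ x y, B x y = B y x)
    (hnd : ∀ x, (∀ y, B x y = 0) → x = 0)
    (p : ℕ) (U : Fin p → Submodule ℝ V) (N P L : Submodule ℝ V) (lam : V)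
    -- `V = U₁ ⊕ ⋯ ⊕ U_p ⊕ N` is a `B`-orthogonal direct sum decomposition
    (hindep : iSupIndep (fun o : Option (Fin p) => o.elim N U))
    (hspan : (⨆ o : Option (Fin p), o.elim N U) = ⊤)
    (horth : ∀ o o' : Option (Fin p), o ≠ o' →
      ∀ x ∈ o.elim N U, ∀ y ∈ o'.elim N U, B x y = 0)
    -- each `U i` is two-dimensional of signature `(1,1)`: `B` restricted to it is nondegenerate
    -- and indefinite
    (hU2 : ∀ i, Module.finrank ℝ ↥(U i) = 2)
    (hUnd : ∀ i, ∀ x ∈ U i, (∀ y ∈ U i, B x y = 0) → x = 0)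
    (hUindef : ∀ i, (∃ x ∈ U i, 0 < B x x) ∧ (∃ x ∈ U i, B x x < 0))
    -- `N` is negative definite
    (hNneg : ∀ x ∈ N, x ≠ 0 → B x x < 0)
    -- `V = P ⊕ L`, where `L` is a negative line spanned by `λ` and `P` is the `B`-orthogonal
    -- complement of `L`
    (hlam : B lam lam < 0)
    (hLspan : L = Submodule.span ℝ {lam})
    (hP : ∀ x, x ∈ P ↔ ∀ y ∈ L, B x y = 0)
    (hPL : IsCompl P L)
    -- general position: each `P ∩ U i` is a positive line, and `N^⊥ ∩ L = 0`
    (hpos : ∀ i, ∃ v : V, 0 < B v v ∧ P ⊓ U i = Submodule.span ℝ {v})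
    (hNL : ∀ x ∈ L, (∀ y ∈ N, B x y = 0) → x = 0)
    -- the linear map `g`
    (g : V →ₗ[ℝ] V)
    (hgB : ∀ x y, B (g x) (g y) = B x y)
    (hgU : ∀ i, (U i).map g = U i)
    (hgiso : ∀ i, ∀ v ∈ U i, B v v = 0 →
      (Submodule.span ℝ {v}).map g = Submodule.span ℝ {v})
    (hgN : ∀ x ∈ N, g x = x)
    (hgL : L.map g = L) :
    g = LinearMap.id := by
  subst hLspan
  have hPlam : ∀ x, x ∈ P ↔ B x lam = 0 := fun x => by
    rw [hP]
    refine ⟨fun h => h lam (Submodule.mem_span_singleton_self lam), fun h y hy => ?_⟩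
    obtain ⟨c, rfl⟩ := Submodule.mem_span_singleton.mp hy
    rw [map_smul, h, smul_zero]
  have hglam : g lam = lam := by
    have hlam0 : lam ≠ 0 := by
      rintro rfl
      simp at hlam
    obtain ⟨n, hn, hne⟩ : ∃ n ∈ N, B lam n ≠ 0 := by
      by_contra! h
      exact hlam0 (hNL lam (Submodule.mem_span_singleton_self lam) h)
    exact LinearMap.BilinForm.apply_eq_self_of_map_span_eq hgB (hgN n hn) hgL hne
  have hfix : ∀ i, ∀ x ∈ U i, g x = x := by
    intro i x hx
    obtain ⟨v, hv, hPU⟩ := hpos i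
    obtain ⟨hvP, hvU⟩ : v ∈ P ⊓ U i := hPU ▸ Submodule.mem_span_singleton_self v
    have hmul : ∀ y ∈ U i, B y lam = 0 → ∃ c : ℝ, c • v = y := fun y hy h =>
      Submodule.mem_span_singleton.mp (hPU ▸ ⟨(hPlam y).mpr h, hy⟩)
    have hiso : ∀ y ∈ U i, B y y = 0 → g y = y := by
      intro y hy hyy
      by_cases h : B y lam = 0
      · obtain ⟨c, rfl⟩ := hmul y hy h
        have hc : c = 0 := by simpa [hv.ne'] using hyy
        simp [hc]
      · exact LinearMap.BilinForm.apply_eq_self_of_map_span_eq hgB hglam (hgiso i y hy hyy) h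
    obtain ⟨n, hnU, hn⟩ := (hUindef i).2
    have hnlam : B n lam ≠ 0 := by
      intro h
      obtain ⟨c, rfl⟩ := hmul n hnU h
      simp only [map_smul, LinearMap.smul_apply, smul_eq_mul] at hn
      nlinarith [mul_nonneg (mul_self_nonneg c) hv.le]
    obtain ⟨a, ha⟩ : ∃ a : ℝ, a * B v v = B v n := ⟨B v n / B v v, div_mul_cancel₀ _ hv.ne'⟩
    have hwU : n - a • v ∈ U i := (U i).sub_mem hnU ((U i).smul_mem a hvU)
    have hvw : B v (n - a • v) = 0 := by
      simp [ha]
    have hww : B (n - a • v) (n - a • v) < 0 := by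
      simp only [map_sub, map_smul, LinearMap.sub_apply, LinearMap.smul_apply, smul_eq_mul,
        hsymm n v, ← ha]
      nlinarith [mul_nonneg (mul_self_nonneg a) hv.le]
    obtain ⟨hgv, hgw⟩ :=
      LinearMap.BilinForm.apply_eq_self_of_fixes_isotropic hsymm hiso hvU hwU hvw hv hww
    have hgn : g n = n := by
      simpa [hgv] using hgw
    obtain ⟨c, hc⟩ := hmul (x - (B x lam / B n lam) • n)
      ((U i).sub_mem hx ((U i).smul_mem _ hnU)) (by simp [hnlam])
    rw [← sub_add_cancel x ((B x lam / B n lam) • n), ← hc, map_add, map_smul, map_smul, hgv, hgn]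
  have htop : ⊤ ≤ LinearMap.eqLocus g LinearMap.id := by
    rw [← hspan]
    refine iSup_le fun o => ?_
    cases o with
    | none => exact hgN
    | some i => exact hfix i
  exact LinearMap.ext fun x => htop Submodule.mem_top
end

section
/- Let a group Γ act on a set X. Let X₁, X₂ ⊆ X be subsets and Γ₁, Γ₂ ≤ Γ subgroups such that for i = 1,2: Γ_i · X_i ⊆ X_i, and for every γ ∈ Γ, if γ·X_i ∩ X_i ≠ ∅ then γ ∈ Γ_i. Let Π : X → Γ\X denote the quotient map onto the set of Γ-orbits. Define T = {(γ, x₁, x₂) ∈ Γ × X₁ × X₂ : γ·x₁ = x₂}, with the group Γ₂ × Γ₁ acting on T by (α₂, α₁)·(γ, x₁, x₂) = (α₂ γ α₁⁻¹, α₁·x₁, α₂·x₂). Then the map (γ, x₁, x₂) ↦ Π(x₂) induces a bijection between the orbit set T/(Γ₂ × Γ₁) and the intersection Π(X₁) ∩ Π(X₂) inside Γ\X. -/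
/-- The quotient map `X → Γ\X` onto the set of orbits of a group action. -/
def orbitProj (Γ X : Type*) [Group Γ] [MulAction Γ X] :
    X → Quotient (MulAction.orbitRel Γ X) :=
  Quotient.mk (MulAction.orbitRel Γ X)

/-- components of `Y₁ ∩ Y₂` as a double coset space. Let `Γ` act on `X`, let
`X₁, X₂ ⊆ X` and `Γ₁, Γ₂ ≤ Γ` with `Γᵢ · Xᵢ ⊆ Xᵢ` and such that `γ Xᵢ ∩ Xᵢ ≠ ∅` forces
`γ ∈ Γᵢ`. Let `T = {(γ, x₁, x₂) : γ x₁ = x₂}` with the `Γ₂ × Γ₁`-action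
`(α₂, α₁)·(γ, x₁, x₂) = (α₂ γ α₁⁻¹, α₁ x₁, α₂ x₂)`. Then `(γ, x₁, x₂) ↦ Π(x₂)` induces a
bijection of `T/(Γ₂ × Γ₁)` with `Π(X₁) ∩ Π(X₂)`: it takes values in the intersection, hits every
point of the intersection, and two triples have the same image iff they lie in the same
`Γ₂ × Γ₁`-orbit. -/
theorem intersection_orbit_bijection
    (Γ X : Type*) [Group Γ] [MulAction Γ X]
    (X₁ X₂ : Set X) (Γ₁ Γ₂ : Subgroup Γ)
    (h1 : ∀ γ ∈ Γ₁, ∀ x ∈ X₁, γ • x ∈ X₁)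
    (h2 : ∀ γ ∈ Γ₂, ∀ x ∈ X₂, γ • x ∈ X₂)
    (h1' : ∀ γ : Γ, (∃ x ∈ X₁, γ • x ∈ X₁) → γ ∈ Γ₁)
    (h2' : ∀ γ : Γ, (∃ x ∈ X₂, γ • x ∈ X₂) → γ ∈ Γ₂) :
    -- the map takes values in `Π(X₁) ∩ Π(X₂)`
    (∀ γ : Γ, ∀ x₁ ∈ X₁, ∀ x₂ ∈ X₂, γ • x₁ = x₂ →
      orbitProj Γ X x₂ ∈ (orbitProj Γ X '' X₁) ∩ (orbitProj Γ X '' X₂)) ∧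
    -- every point of `Π(X₁) ∩ Π(X₂)` arises
    (∀ y ∈ (orbitProj Γ X '' X₁) ∩ (orbitProj Γ X '' X₂),
      ∃ γ : Γ, ∃ x₁ ∈ X₁, ∃ x₂ ∈ X₂, γ • x₁ = x₂ ∧ orbitProj Γ X x₂ = y) ∧
    -- two triples have the same image iff they are in the same `Γ₂ × Γ₁`-orbit
    (∀ γ γ' : Γ, ∀ x₁ ∈ X₁, ∀ x₂ ∈ X₂, ∀ x₁' ∈ X₁, ∀ x₂' ∈ X₂,
      γ • x₁ = x₂ → γ' • x₁' = x₂' →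
      (orbitProj Γ X x₂ = orbitProj Γ X x₂' ↔
        ∃ α₂ ∈ Γ₂, ∃ α₁ ∈ Γ₁, γ' = α₂ * γ * α₁⁻¹ ∧ x₁' = α₁ • x₁ ∧ x₂' = α₂ • x₂)) := by
  have proj_eq_iff : ∀ x x' : X, orbitProj Γ X x = orbitProj Γ X x' ↔ ∃ δ : Γ, δ • x = x' :=
    fun x x' => eq_comm.trans Quotient.eq
  refine ⟨?_, ?_, ?_⟩
  · intro γ x₁ hx₁ x₂ hx₂ h
    exact ⟨⟨x₁, hx₁, (proj_eq_iff _ _).2 ⟨γ, h⟩⟩, ⟨x₂, hx₂, rfl⟩⟩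
  · rintro y ⟨⟨x₁, hx₁, h⟩, ⟨x₂, hx₂, rfl⟩⟩
    obtain ⟨γ, hγ⟩ := (proj_eq_iff _ _).1 h
    exact ⟨γ, x₁, hx₁, x₂, hx₂, hγ, rfl⟩
  · intro γ γ' x₁ hx₁ x₂ hx₂ x₁' hx₁' x₂' hx₂' h h'
    rw [proj_eq_iff]
    constructor
    · rintro ⟨δ, hδ⟩
      have hα : (γ'⁻¹ * δ * γ) • x₁ = x₁' := by
        rw [mul_smul, mul_smul, h, hδ, ← h', inv_smul_smul]
      exact ⟨δ, h2' δ ⟨x₂, hx₂, hδ.symm ▸ hx₂'⟩, γ'⁻¹ * δ * γ,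
        h1' _ ⟨x₁, hx₁, hα.symm ▸ hx₁'⟩, by group, hα.symm, hδ.symm⟩
    · rintro ⟨α₂, -, α₁, -, -, -, hα₂⟩
      exact ⟨α₂, hα₂.symm⟩
end

section
/- Let G be a group and let N be a normal subgroup of G that is perfect, i.e. N equals its own commutator subgroup (equivalently, the abelianization of N is trivial). Then the homomorphism H₂(G;ℚ) → H₂(G/N;ℚ) on second group homology with trivial rational coefficients, induced by the quotient map G → G/N, is surjective. -/
/-! Second group homology `H₂(G; ℚ)` with trivial rational coefficients, defined via the
inhomogeneous bar complex `ℚ[G³] → ℚ[G²] → ℚ[G]` in degrees `3, 2, 1`, together with the map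
induced by a group homomorphism. -/

namespace GroupHomologyTwo

variable (G : Type) [Group G]

/-- The inhomogeneous bar differential in degree 2: `(g, h) ↦ [h] − [gh] + [g]`. -/
noncomputable def d2 : ((G × G) →₀ ℚ) →ₗ[ℚ] (G →₀ ℚ) :=
  Finsupp.lift (G →₀ ℚ) ℚ (G × G) fun g =>
    Finsupp.single g.2 1 - Finsupp.single (g.1 * g.2) 1 + Finsupp.single g.1 1

/-- The inhomogeneous bar differential in degree 3:
`(g, h, k) ↦ [h, k] − [gh, k] + [g, hk] − [g, h]`. -/
noncomputable def d3 : ((G × G × G) →₀ ℚ) →ₗ[ℚ] ((G × G) →₀ ℚ) :=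
  Finsupp.lift ((G × G) →₀ ℚ) ℚ (G × G × G) fun g =>
    Finsupp.single (g.2.1, g.2.2) 1 - Finsupp.single (g.1 * g.2.1, g.2.2) 1 +
      Finsupp.single (g.1, g.2.1 * g.2.2) 1 - Finsupp.single (g.1, g.2.1) 1

/-- The 2-boundaries, viewed as a submodule of the 2-cycles. -/
noncomputable def boundaries : Submodule ℚ ↥(LinearMap.ker (d2 G)) :=
  Submodule.comap (LinearMap.ker (d2 G)).subtype (LinearMap.range (d3 G))

/-- `H₂(G; ℚ)`: 2-cycles modulo 2-boundaries. -/
abbrev H2 : Type :=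
  ↥(LinearMap.ker (d2 G)) ⧸ boundaries G

variable {G} {Q : Type} [Group Q]

/-- The chain map in degree 1 induced by a group homomorphism. -/
noncomputable def map1 (φ : G →* Q) : (G →₀ ℚ) →ₗ[ℚ] (Q →₀ ℚ) :=
  Finsupp.lmapDomain ℚ ℚ φ

/-- The chain map in degree 2 induced by a group homomorphism. -/
noncomputable def map2 (φ : G →* Q) : ((G × G) →₀ ℚ) →ₗ[ℚ] ((Q × Q) →₀ ℚ) :=
  Finsupp.lmapDomain ℚ ℚ (Prod.map φ φ)

/-- The chain map in degree 3 induced by a group homomorphism. -/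
noncomputable def map3 (φ : G →* Q) : ((G × G × G) →₀ ℚ) →ₗ[ℚ] ((Q × Q × Q) →₀ ℚ) :=
  Finsupp.lmapDomain ℚ ℚ (Prod.map φ (Prod.map φ φ))

lemma comm2 (φ : G →* Q) : (d2 Q).comp (map2 φ) = (map1 φ).comp (d2 G) := by
  apply Finsupp.lhom_ext
  intro a c
  simp [d2, map1, map2, Finsupp.lift_apply, Finsupp.sum_single_index,
    Finsupp.lmapDomain_apply, Finsupp.mapDomain_single, map_add, map_sub, map_smul,
    Finsupp.mapDomain_add, Finsupp.mapDomain_smul]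

lemma comm3 (φ : G →* Q) : (d3 Q).comp (map3 φ) = (map2 φ).comp (d3 G) := by
  apply Finsupp.lhom_ext
  intro a c
  simp [d3, map2, map3, Finsupp.lift_apply, Finsupp.sum_single_index,
    Finsupp.lmapDomain_apply, Finsupp.mapDomain_single, map_add, map_sub, map_smul,
    Finsupp.mapDomain_add, Finsupp.mapDomain_smul]

lemma map2_ker (φ : G →* Q) :
    ∀ x ∈ LinearMap.ker (d2 G), map2 φ x ∈ LinearMap.ker (d2 Q) := by
  intro x hx
  rw [LinearMap.mem_ker] at hx ⊢
  have := LinearMap.congr_fun (comm2 φ) x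
  simp only [LinearMap.comp_apply] at this
  rw [this, hx, map_zero]

/-- The map `H₂(G; ℚ) → H₂(Q; ℚ)` induced by a group homomorphism `φ : G → Q`. -/
noncomputable def H2Map (φ : G →* Q) : H2 G →ₗ[ℚ] H2 Q := by
  refine Submodule.mapQ (boundaries G) (boundaries Q)
    ((map2 φ).restrict (map2_ker φ)) ?_
  intro x hx
  obtain ⟨y, hy⟩ := hx
  refine Submodule.mem_comap.mpr ?_
  refine ⟨map3 φ y, ?_⟩
  have := LinearMap.congr_fun (comm3 φ) y
  simp only [LinearMap.comp_apply] at this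
  have hval : ((map2 φ).restrict (map2_ker φ) ⟨x, x.2⟩ :
      (Q × Q) →₀ ℚ) = map2 φ (x : (G × G) →₀ ℚ) := rfl
  rw [this, hy]
  exact hval.symm

end GroupHomologyTwo

namespace GroupHomologyTwo

variable {G Q : Type} [Group G] [Group Q]

lemma d2_single (g h : G) (c : ℚ) :
    d2 G (Finsupp.single (g, h) c) = Finsupp.single h c - Finsupp.single (g * h) c + Finsupp.single g c := by
  simp [d2, Finsupp.lift_apply, smul_add, smul_sub]

lemma d3_single (g h k : G) (c : ℚ) :
    d3 G (Finsupp.single (g, h, k) c) =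
      Finsupp.single (h, k) c - Finsupp.single (g * h, k) c + Finsupp.single (g, h * k) c - Finsupp.single (g, h) c := by
  simp [d3, Finsupp.lift_apply, smul_add, smul_sub]

lemma map2_single (φ : G →* Q) (g h : G) (c : ℚ) :
    map2 φ (Finsupp.single (g, h) c) = Finsupp.single (φ g, φ h) c := by
  simp [map2, Finsupp.lmapDomain_apply, Finsupp.mapDomain_single]

/-- The elements `n` whose class `[n]` bounds a 2-chain lying over the 2-chain `(1, 1)` of `Q`,
as a subgroup of the kernel of `φ`. -/
def boundingSubgroup (φ : G →* Q) : Subgroup G where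
  carrier := {n | φ n = 1 ∧ ∃ w, d2 G w = Finsupp.single n 1 ∧ map2 φ w = Finsupp.single (1, 1) 1}
  one_mem' := ⟨map_one φ, Finsupp.single (1, 1) 1, by simp [d2_single], by simp [map2_single]⟩
  mul_mem' := by
    rintro n m ⟨hn, w, hw, hw'⟩ ⟨hm, v, hv, hv'⟩
    refine ⟨by simp [hn, hm], w + v - Finsupp.single (n, m) 1, ?_, ?_⟩
    · rw [map_sub, map_add, hw, hv, d2_single]
      abel
    · simp [hw', hv', map2_single, hn, hm]
  inv_mem' := by
    rintro n ⟨hn, w, hw, hw'⟩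
    refine ⟨by simp [hn], Finsupp.single (n, n⁻¹) 1 + Finsupp.single (1, 1) 1 - w, ?_, ?_⟩
    · rw [map_sub, map_add, hw, d2_single, d2_single, mul_inv_cancel, mul_one]
      abel
    · simp [hw', map2_single, hn]

open scoped commutatorElement in
lemma commutator_ker_le_boundingSubgroup (φ : G →* Q) :
    ⁅φ.ker, φ.ker⁆ ≤ boundingSubgroup φ := by
  rw [Subgroup.commutator_le]
  intro n hn m hm
  rw [MonoidHom.mem_ker] at hn hm
  refine ⟨by simp [commutatorElement_def, hn, hm],
    Finsupp.single (⁅n, m⁆, m * n) 1 - Finsupp.single (n, m) 1 + Finsupp.single (m, n) 1, ?_, ?_⟩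
  · have h : ⁅n, m⁆ * (m * n) = n * m := by simp [commutatorElement_def, mul_assoc]
    rw [map_add, map_sub, d2_single, d2_single, d2_single, h]
    abel
  · simp [map2_single, commutatorElement_def, hn, hm]

/-- If the kernel of `φ` is perfect, a 1-chain differs from the lift of its image along a section
of `φ` by the boundary of a 2-chain whose image is itself a boundary. -/
lemma exists_d2_eq_sub_lift (φ : G →* Q) (hφ : φ.ker ≤ ⁅φ.ker, φ.ker⁆) (s : Q → G)
    (hs : Function.RightInverse s φ) (a : G →₀ ℚ) :
    ∃ y, d2 G y = Finsupp.lmapDomain ℚ ℚ s (map1 φ a) - a ∧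
      map2 φ y ∈ LinearMap.range (d3 Q) := by
  induction a using Finsupp.induction_linear with
  | zero => exact ⟨0, by simp, by simp⟩
  | add a b ha hb =>
    obtain ⟨y, hy, hy'⟩ := ha
    obtain ⟨z, hz, hz'⟩ := hb
    refine ⟨y + z, ?_, by rw [map_add]; exact add_mem hy' hz'⟩
    rw [map_add, map_add, map_add, hy, hz]
    abel
  | single g c =>
    have hker : g⁻¹ * s (φ g) ∈ φ.ker := by simp [MonoidHom.mem_ker, hs (φ g)]
    obtain ⟨h1, w, hw, hw'⟩ := commutator_ker_le_boundingSubgroup φ (hφ hker)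
    refine ⟨c • w - Finsupp.single (g, g⁻¹ * s (φ g)) c, ?_, Finsupp.single (φ g, 1, 1) c, ?_⟩
    · rw [map_sub, map_smul, hw, d2_single, mul_inv_cancel_left]
      simp only [map1, Finsupp.lmapDomain_apply, Finsupp.mapDomain_single, Finsupp.smul_single,
        smul_eq_mul, mul_one]
      abel
    · rw [map_sub, map_smul, hw', map2_single, h1, d3_single]
      simp

lemma H2Map_surjective_of_ker_le_commutator (φ : G →* Q) (hsurj : Function.Surjective φ)
    (hφ : φ.ker ≤ ⁅φ.ker, φ.ker⁆) : Function.Surjective (H2Map φ) := by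
  intro q
  obtain ⟨⟨z, hz⟩, rfl⟩ := Submodule.Quotient.mk_surjective _ q
  obtain ⟨s, hs⟩ := hsurj.hasRightInverse
  set z' : (G × G) →₀ ℚ := Finsupp.lmapDomain ℚ ℚ (Prod.map s s) z
  have hz' : map2 φ z' = z := by
    have h : Prod.map φ φ ∘ Prod.map s s = id := by
      ext x <;> simp [hs _]
    simp only [z', map2, Finsupp.lmapDomain_apply]
    rw [← Finsupp.mapDomain_comp, h, Finsupp.mapDomain_id]
  obtain ⟨y, hy, t, ht⟩ := exists_d2_eq_sub_lift φ hφ s hs (d2 G z')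
  have h0 : map1 φ (d2 G z') = 0 := by
    rw [← LinearMap.comp_apply, ← comm2, LinearMap.comp_apply, hz', LinearMap.mem_ker.mp hz]
  rw [h0, map_zero, zero_sub] at hy
  have hx : z' + y ∈ LinearMap.ker (d2 G) := by
    rw [LinearMap.mem_ker, map_add, hy, add_neg_cancel]
  refine ⟨Submodule.Quotient.mk ⟨z' + y, hx⟩, ?_⟩
  refine (Submodule.Quotient.eq _).mpr ⟨t, ?_⟩
  rw [ht]
  change _ = map2 φ (z' + y) - z
  rw [map_add, hz', add_sub_cancel_left]

end GroupHomologyTwo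

open GroupHomologyTwo

/-- If `N` is a perfect normal subgroup of `G` (i.e. `N` equals its own
commutator subgroup), then the induced map `H₂(G; ℚ) → H₂(G/N; ℚ)` on second group homology with
trivial rational coefficients is surjective. -/
theorem h2_surjective_of_perfect_normal
    (G : Type) [Group G] (N : Subgroup G) [N.Normal]
    (hperf : commutator ↥N = ⊤) :
    Function.Surjective (H2Map (QuotientGroup.mk' N)) := by
  refine H2Map_surjective_of_ker_le_commutator _ (QuotientGroup.mk'_surjective N) ?_
  have h := congrArg (Subgroup.map N.subtype) hperf
  rw [commutator_def, Subgroup.map_commutator, ← MonoidHom.range_eq_map,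
    Subgroup.range_subtype] at h
  rw [QuotientGroup.ker_mk', h]
end
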